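/- arXiv:1505.04128 — 2 statements merged into one kernel-verified Lean document; each statement's English description precedes it below -/
import Mathlib

section
/- Let G = G1 × ... × Gk be a finite abelian group with Gi cyclic of order ni, acting trivially on an abelian group A. Then H^2(G, A) is isomorphic to the direct sum of A/niA for i = 1,...,k, together with the direct sum over all pairs 1 ≤ i < j ≤ k of Ann_A(ni) ∩ Ann_A(nj), where Ann_A(n) = {a ∈ A : na = 0}. -/
/-- The group of (inhomogeneous) 2-cocycles of a group `G` with coefficients in an
abelian group `A` (written multiplicatively), with respect to the trivial action. -/
def cocycles2 (G A : Type*) [Group G] [CommGroup A] : Subgroup (G × G → A) where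
  carrier := {C | ∀ a b c : G, C (b, c) * C (a, b * c) = C (a * b, c) * C (a, b)}
  one_mem' := by intro a b c; simp
  mul_mem' := by
    intro C D hC hD a b c
    simp only [Pi.mul_apply]
    rw [mul_mul_mul_comm, hC a b c, hD a b c, mul_mul_mul_comm]
  inv_mem' := by
    intro C hC a b c
    simp only [Pi.inv_apply]
    rw [← mul_inv, hC a b c, mul_inv]

/-- The group of 2-coboundaries. -/
def coboundaries2 (G A : Type*) [Group G] [CommGroup A] : Subgroup (G × G → A) where
  carrier := {C | ∃ ρ : G → A, ∀ p : G × G, C p = ρ p.1 * ρ p.2 * (ρ (p.1 * p.2))⁻¹}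
  one_mem' := ⟨fun _ => 1, by simp⟩
  mul_mem' := by
    rintro C D ⟨ρ, hρ⟩ ⟨σ, hσ⟩
    refine ⟨fun g => ρ g * σ g, fun p => ?_⟩
    simp only [Pi.mul_apply, hρ p, hσ p, mul_inv]
    simp [mul_assoc, mul_comm, mul_left_comm]
  inv_mem' := by
    rintro C ⟨ρ, hρ⟩
    refine ⟨fun g => (ρ g)⁻¹, fun p => ?_⟩
    simp only [Pi.inv_apply, hρ p, mul_inv, inv_inv]

/-- Second group cohomology of `G` with coefficients in `A`, with trivial `G`-action:
2-cocycles modulo 2-coboundaries. -/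
def H2triv (G A : Type*) [Group G] [CommGroup A] :=
  cocycles2 G A ⧸ ((coboundaries2 G A).subgroupOf (cocycles2 G A))

noncomputable instance (G A : Type*) [Group G] [CommGroup A] : Group (H2triv G A) :=
  QuotientGroup.Quotient.group _

namespace H2aux

/-- The homomorphism from `ZMod n` sending the generator to `b`. -/
def powHom (n : ℕ) [NeZero n] {M : Type*} [Monoid M] (b : M) (hb : b ^ n = 1) :
    Multiplicative (ZMod n) →* M where
  toFun x := b ^ (Multiplicative.toAdd x).val
  map_one' := by simp
  map_mul' x y := by
    rw [toAdd_mul, ZMod.val_add, ← pow_add]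
    conv_rhs => rw [← Nat.div_add_mod ((Multiplicative.toAdd x).val + (Multiplicative.toAdd y).val) n]
    rw [pow_add, pow_mul, hb, one_pow, one_mul]

lemma powHom_apply (n : ℕ) [NeZero n] {M : Type*} [Monoid M] (b : M) (hb : b ^ n = 1)
    (x : Multiplicative (ZMod n)) : powHom n b hb x = b ^ (Multiplicative.toAdd x).val := rfl

lemma gen_pow_val (n : ℕ) [NeZero n] (x : Multiplicative (ZMod n)) :
    (Multiplicative.ofAdd (1 : ZMod n)) ^ (Multiplicative.toAdd x).val = x := by
  apply Multiplicative.toAdd.injective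
  simp

lemma gen_pow_self (n : ℕ) : (Multiplicative.ofAdd (1 : ZMod n)) ^ n = 1 := by
  apply Multiplicative.toAdd.injective
  simp

section general
variable {G A : Type*} [CommGroup G] [CommGroup A]

lemma coc (C : cocycles2 G A) (a b c : G) :
    C.1 (b, c) * C.1 (a, b * c) = C.1 (a * b, c) * C.1 (a, b) := C.2 a b c

lemma coc_one_left (C : cocycles2 G A) (g : G) : C.1 (1, g) = C.1 (1, 1) := by
  have := coc C 1 1 g
  simpa using this

lemma coc_one_right (C : cocycles2 G A) (g : G) : C.1 (g, 1) = C.1 (1, 1) := by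
  have := coc C g 1 1
  simpa using this.symm

/-- commutator pairing -/
def om (C : cocycles2 G A) (h : G) : G →* A where
  toFun g := C.1 (g, h) * (C.1 (h, g))⁻¹
  map_one' := by rw [coc_one_left C h, coc_one_right C h]; simp
  map_mul' g g' := by
    have h1 := coc C g g' h
    have h2 := coc C h g g'
    have h3 := coc C g h g'
    rw [mul_comm h g] at h2
    rw [mul_comm h g'] at h3
    have e1 : C.1 (g * g', h) = C.1 (g', h) * C.1 (g, g' * h) * (C.1 (g, g'))⁻¹ := by
      rw [h1]; simp
    have e2 : C.1 (h, g * g') = C.1 (g * h, g') * C.1 (h, g) * (C.1 (g, g'))⁻¹ := by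
      rw [← h2, mul_comm]; simp
    have e3 : C.1 (g, g' * h) = C.1 (g * h, g') * C.1 (g, h) * (C.1 (h, g'))⁻¹ := by
      rw [← h3, mul_comm]; simp
    rw [e1, e2, e3]
    apply Additive.ofMul.injective
    simp only [ofMul_mul, ofMul_inv]
    abel

lemma om_apply (C : cocycles2 G A) (h g : G) : om C h g = C.1 (g, h) * (C.1 (h, g))⁻¹ := rfl

lemma om_symm (C : cocycles2 G A) (h g : G) : om C h g = (om C g h)⁻¹ := by
  simp [om_apply]

lemma om_self (C : cocycles2 G A) (g : G) : om C g g = 1 := by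
  simp [om_apply]

/-- norm -/
def nrm (n : ℕ) (e : G) : cocycles2 G A →* A where
  toFun C := ∏ t ∈ Finset.range n, C.1 (e, e ^ t)
  map_one' := by simp
  map_mul' C D := by simp [Finset.prod_mul_distrib]

lemma nrm_apply (n : ℕ) (e : G) (C : cocycles2 G A) :
    nrm n e C = ∏ t ∈ Finset.range n, C.1 (e, e ^ t) := rfl

lemma nrm_cob (n : ℕ) (e : G) (he : e ^ n = 1) (C : cocycles2 G A) (ρ : G → A)
    (hρ : ∀ p : G × G, C.1 p = ρ p.1 * ρ p.2 * (ρ (p.1 * p.2))⁻¹) :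
    nrm n e C = ρ e ^ n := by
  have key : ∀ m, ∏ t ∈ Finset.range m, C.1 (e, e ^ t) = ρ e ^ m * ρ 1 * (ρ (e ^ m))⁻¹ := by
    intro m
    induction m with
    | zero => simp
    | succ m ih =>
      rw [Finset.prod_range_succ, ih, hρ, pow_succ', pow_succ']
      apply Additive.ofMul.injective
      simp only [ofMul_mul, ofMul_inv]
      abel
  rw [nrm_apply, key, he]; simp

/-- the extension attached to a cocycle -/
@[ext] structure Ext (C : cocycles2 G A) where
  a : A
  g : G

/-- the commutative group structure on the extension attached to a symmetric cocycle -/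
@[reducible] def extGroup (C : cocycles2 G A) (hs : ∀ g h, C.1 (g, h) = C.1 (h, g)) :
    CommGroup (Ext C) :=
  letI : Mul (Ext C) := ⟨fun x y => ⟨x.a * y.a * C.1 (x.g, y.g), x.g * y.g⟩⟩
  letI : One (Ext C) := ⟨⟨(C.1 (1, 1))⁻¹, 1⟩⟩
  letI : Inv (Ext C) := ⟨fun x => ⟨x.a⁻¹ * (C.1 (x.g⁻¹, x.g))⁻¹ * (C.1 (1, 1))⁻¹, x.g⁻¹⟩⟩
  letI : Group (Ext C) := Group.ofLeftAxioms
    (by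
      intro x y z
      refine Ext.ext ?_ (mul_assoc _ _ _)
      change x.a * y.a * C.1 (x.g, y.g) * z.a * C.1 (x.g * y.g, z.g) =
        x.a * (y.a * z.a * C.1 (y.g, z.g)) * C.1 (x.g, y.g * z.g)
      have h := coc C x.g y.g z.g
      calc _ = x.a * y.a * z.a * (C.1 (x.g * y.g, z.g) * C.1 (x.g, y.g)) := by
              simp only [mul_assoc, mul_comm, mul_left_comm]
        _ = _ := by
              rw [← h]
              simp only [mul_assoc, mul_comm, mul_left_comm])
    (by
      intro x
      refine Ext.ext ?_ (one_mul _)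
      change (C.1 (1, 1))⁻¹ * x.a * C.1 (1, x.g) = x.a
      rw [coc_one_left C x.g, mul_right_comm, inv_mul_cancel, one_mul])
    (by
      intro x
      refine Ext.ext ?_ (inv_mul_cancel _)
      change x.a⁻¹ * (C.1 (x.g⁻¹, x.g))⁻¹ * (C.1 (1, 1))⁻¹ * x.a * C.1 (x.g⁻¹, x.g) = (C.1 (1, 1))⁻¹
      apply Additive.ofMul.injective
      simp only [ofMul_mul, ofMul_inv]
      abel)
  { (inferInstance : Group (Ext C)) with
    mul_comm := by
      intro x y
      refine Ext.ext ?_ (mul_comm _ _)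
      change x.a * y.a * C.1 (x.g, y.g) = y.a * x.a * C.1 (y.g, x.g)
      rw [hs, mul_comm x.a] }

end general

section prod
variable {k : ℕ} (n : Fin k → ℕ) {A : Type*} [CommGroup A]

/-- generators -/
abbrev gen (i : Fin k) : ∀ i, Multiplicative (ZMod (n i)) :=
  Pi.mulSingle i (Multiplicative.ofAdd 1)

lemma gen_pow (i : Fin k) : gen n i ^ n i = 1 := by
  rw [gen, ← Pi.mulSingle_pow, gen_pow_self, Pi.mulSingle_one]

lemma hom_ext' [∀ i, NeZero (n i)] {M : Type*} [CommMonoid M]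
    (f f' : (∀ i, Multiplicative (ZMod (n i))) →* M)
    (h : ∀ i, f (gen n i) = f' (gen n i)) : f = f' := by
  refine MonoidHom.pi_ext fun i x => ?_
  rw [← gen_pow_val (n i) x, Pi.mulSingle_pow, map_pow, map_pow]
  exact congrArg (· ^ _) (h i)

lemma symm_of_gen [∀ i, NeZero (n i)] (C : cocycles2 (∀ i, Multiplicative (ZMod (n i))) A)
    (h : ∀ i j, i < j → om C (gen n j) (gen n i) = 1) (g g') : C.1 (g, g') = C.1 (g', g) := by
  have h1 : ∀ i j, om C (gen n j) (gen n i) = 1 := by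
    intro i j
    rcases lt_trichotomy i j with hij | rfl | hij
    · exact h i j hij
    · exact om_self _ _
    · rw [om_symm, h j i hij, inv_one]
  have h2 : ∀ j, om C (gen n j) = 1 := fun j => hom_ext' n _ _ fun i => h1 i j
  have h3 : ∀ x, om C x = 1 := fun x => hom_ext' n _ _ fun i => by
    rw [om_symm, h2]; simp
  have h4 : om C g' g = 1 := by rw [h3]; rfl
  rw [om_apply] at h4
  exact mul_inv_eq_one.mp h4

lemma split [∀ i, NeZero (n i)] (C : cocycles2 (∀ i, Multiplicative (ZMod (n i))) A)
    (hs : ∀ g h, C.1 (g, h) = C.1 (h, g))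
    (hN : ∀ i, ∃ β : A, β ^ n i = nrm (n i) (gen n i) C) : C.1 ∈ coboundaries2 _ A := by
  letI := extGroup C hs
  choose β hβ using hN
  have hmul : ∀ x y : Ext C, x * y = ⟨x.a * y.a * C.1 (x.g, y.g), x.g * y.g⟩ := fun _ _ => rfl
  have hone : (1 : Ext C) = ⟨(C.1 (1, 1))⁻¹, 1⟩ := rfl
  have hpow : ∀ (α : A) e (m : ℕ), (⟨α, e⟩ : Ext C) ^ m =
      ⟨(C.1 (1, 1))⁻¹ * α ^ m * ∏ t ∈ Finset.range m, C.1 (e, e ^ t), e ^ m⟩ := by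
    intro α e m
    induction m with
    | zero => simp [hone]
    | succ m ih =>
      rw [pow_succ', ih, hmul, Finset.prod_range_succ, pow_succ', pow_succ']
      refine Ext.ext ?_ rfl
      simp only [mul_assoc, mul_comm, mul_left_comm]
  have hx : ∀ i, (⟨(β i)⁻¹, gen n i⟩ : Ext C) ^ n i = 1 := by
    intro i
    rw [hpow, ← nrm_apply, ← hβ, gen_pow, hone]
    refine Ext.ext ?_ rfl
    simp
  let s : (∀ i, Multiplicative (ZMod (n i))) →* Ext C :=
    ∏ i, (powHom (n i) _ (hx i)).comp (Pi.evalMonoidHom _ i)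
  let π : Ext C →* (∀ i, Multiplicative (ZMod (n i))) :=
    { toFun := fun x => x.g, map_one' := rfl, map_mul' := fun _ _ => rfl }
  have hπ : ∀ g, (s g).g = g := by
    intro g
    change π (s g) = g
    have : s g = ∏ i, powHom (n i) _ (hx i) (g i) := by
      simp [s, MonoidHom.finsetProd_apply]
    rw [this, map_prod]
    conv_rhs => rw [← Finset.univ_prod_mulSingle g]
    refine Finset.prod_congr rfl fun i _ => ?_
    rw [powHom_apply, map_pow]
    change gen n i ^ _ = _
    rw [gen, ← Pi.mulSingle_pow, gen_pow_val]
  refine ⟨fun g => ((s g).a)⁻¹, fun p => ?_⟩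
  have h1 := congrArg Ext.a (map_mul s p.1 p.2)
  rw [hmul] at h1
  simp only [hπ] at h1
  change C.1 (p.1, p.2) = ((s p.1).a)⁻¹ * ((s p.2).a)⁻¹ * (((s (p.1 * p.2)).a)⁻¹)⁻¹
  rw [h1]
  apply Additive.ofMul.injective
  simp only [ofMul_mul, ofMul_inv]
  abel

/-- pair components -/
def pairHom (i j : Fin k) : cocycles2 (∀ i, Multiplicative (ZMod (n i))) A →*
    ((powMonoidHom (n i) : A →* A).ker ⊓ (powMonoidHom (n j) : A →* A).ker : Subgroup A) where
  toFun C := ⟨om C (gen n j) (gen n i), by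
    refine ⟨?_, ?_⟩
    · change om C (gen n j) (gen n i) ^ n i = 1
      rw [← map_pow, gen_pow, map_one]
    · change om C (gen n j) (gen n i) ^ n j = 1
      rw [om_symm, inv_pow, ← map_pow, gen_pow, map_one, inv_one]⟩
  map_one' := by
    apply Subtype.ext
    simp [om_apply]
  map_mul' C D := by
    apply Subtype.ext
    simp only [om_apply, Subgroup.coe_mul, Pi.mul_apply, mul_inv]
    exact mul_mul_mul_comm _ _ _ _

variable (A) in
/-- The total map. -/
def Phi : cocycles2 (∀ i, Multiplicative (ZMod (n i))) A →*
      ((∀ i, A ⧸ (powMonoidHom (n i) : A →* A).range) ×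
        (∀ p : {p : Fin k × Fin k // p.1 < p.2},
          ((powMonoidHom (n p.1.1) : A →* A).ker ⊓
            (powMonoidHom (n p.1.2) : A →* A).ker : Subgroup A))) :=
  MonoidHom.prod
    (MonoidHom.pi fun i => (QuotientGroup.mk' _).comp (nrm (n i) (gen n i)))
    (MonoidHom.pi fun p => pairHom n p.1.1 p.1.2)

lemma Phi_ker [∀ i, NeZero (n i)] :
    (Phi n A).ker = (coboundaries2 _ A).subgroupOf (cocycles2 _ A) := by
  ext C
  rw [Subgroup.mem_subgroupOf, MonoidHom.mem_ker]
  constructor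
  · intro h
    have h1 : ∀ i, ((nrm (n i) (gen n i) C : A) : A ⧸ (powMonoidHom (n i) : A →* A).range) = 1 :=
      fun i => congrFun (congrArg Prod.fst h) i
    have h2 : ∀ p : {p : Fin k × Fin k // p.1 < p.2}, pairHom n p.1.1 p.1.2 C = 1 :=
      fun p => congrFun (congrArg Prod.snd h) p
    apply split
    · apply symm_of_gen
      intro i j hij
      exact congrArg Subtype.val (h2 ⟨(i, j), hij⟩)
    · intro i
      have := h1 i
      rw [QuotientGroup.eq_one_iff] at this
      exact this
  · rintro ⟨ρ, hρ⟩
    refine Prod.ext (funext fun i => ?_) (funext fun p => ?_)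
    · change ((nrm (n i) (gen n i) C : A) : A ⧸ (powMonoidHom (n i) : A →* A).range) = 1
      rw [QuotientGroup.eq_one_iff, nrm_cob _ _ (gen_pow n i) C ρ hρ]
      exact ⟨_, rfl⟩
    · change pairHom n p.1.1 p.1.2 C = 1
      apply Subtype.ext
      change C.1 _ * (C.1 _)⁻¹ = 1
      rw [hρ, hρ, mul_inv_eq_one]
      dsimp only
      rw [mul_comm (ρ _), mul_comm (gen n _)]

/-- The carry cocycle. -/
def carry (i : Fin k) [NeZero (n i)] (a : A) : cocycles2 (∀ i, Multiplicative (ZMod (n i))) A :=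
  ⟨fun p => a ^ (((Multiplicative.toAdd (p.1 i)).val + (Multiplicative.toAdd (p.2 i)).val) / n i), by
    intro x y z
    simp only [Pi.mul_apply, toAdd_mul]
    rw [← pow_add, ← pow_add]
    congr 1
    generalize Multiplicative.toAdd (x i) = x
    generalize Multiplicative.toAdd (y i) = y
    generalize Multiplicative.toAdd (z i) = z
    have key : ∀ u v : ZMod (n i), n i * ((u.val + v.val) / n i) + (u + v).val = u.val + v.val := by
      intro u v
      rw [ZMod.val_add, Nat.div_add_mod]
    have h1 := key y z
    have h2 := key x (y + z)
    have h3 := key (x + y) z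
    have h4 := key x y
    rw [add_assoc] at h3
    apply Nat.eq_of_mul_eq_mul_left (Nat.pos_of_ne_zero (NeZero.ne (n i)))
    rw [mul_add, mul_add]
    omega⟩

lemma carry_apply (i : Fin k) [NeZero (n i)] (a : A) (p) : (carry n i a).1 p =
    a ^ (((Multiplicative.toAdd (p.1 i)).val + (Multiplicative.toAdd (p.2 i)).val) / n i) := rfl

/-- The bilinear cocycle. -/
def bil (i j : Fin k) [NeZero (n i)] [NeZero (n j)] (b : A) (hi : b ^ n i = 1) (hj : b ^ n j = 1) :
    cocycles2 (∀ i, Multiplicative (ZMod (n i))) A :=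
  ⟨fun p => b ^ ((Multiplicative.toAdd (p.1 i)).val * (Multiplicative.toAdd (p.2 j)).val), by
    intro x y z
    have h1 : ∀ (u v : Multiplicative (ZMod (n i))) (c : ℕ),
        b ^ ((Multiplicative.toAdd (u * v)).val * c) =
        b ^ ((Multiplicative.toAdd u).val * c) * b ^ ((Multiplicative.toAdd v).val * c) := by
      intro u v c
      have := congrArg (· ^ c) (map_mul (powHom (n i) b hi) u v)
      simpa only [powHom_apply, mul_pow, ← pow_mul] using this
    have h2 : ∀ (u v : Multiplicative (ZMod (n j))) (c : ℕ),
        b ^ (c * (Multiplicative.toAdd (u * v)).val) =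
        b ^ (c * (Multiplicative.toAdd u).val) * b ^ (c * (Multiplicative.toAdd v).val) := by
      intro u v c
      have := congrArg (· ^ c) (map_mul (powHom (n j) b hj) u v)
      simpa only [powHom_apply, mul_pow, ← pow_mul, mul_comm c] using this
    simp only [Pi.mul_apply]
    rw [h1, h2]
    simp only [mul_assoc, mul_comm, mul_left_comm]⟩

lemma bil_apply (i j : Fin k) [NeZero (n i)] [NeZero (n j)] (b : A) (hi : b ^ n i = 1)
    (hj : b ^ n j = 1) (p) : (bil n i j b hi hj).1 p =
    b ^ ((Multiplicative.toAdd (p.1 i)).val * (Multiplicative.toAdd (p.2 j)).val) := rfl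

lemma gen_ne {i j : Fin k} (h : j ≠ i) : gen n i j = 1 := Pi.mulSingle_eq_of_ne h _

lemma nrm_carry_ne [∀ i, NeZero (n i)] {i j : Fin k} (h : j ≠ i) (a : A) :
    nrm (n i) (gen n i) (carry n j a) = 1 := by
  rw [nrm_apply]
  refine Finset.prod_eq_one fun t _ => ?_
  rw [carry_apply]
  simp only [Pi.pow_apply, gen_ne n h]
  simp

lemma nrm_carry_self [∀ i, NeZero (n i)] (i : Fin k) (a : A) :
    ((nrm (n i) (gen n i) (carry n i a) : A) : A ⧸ (powMonoidHom (n i) : A →* A).range) = a := by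
  by_cases h1 : n i = 1
  · rw [QuotientGroup.eq]
    refine ⟨(nrm (n i) (gen n i) (carry n i a))⁻¹ * a, ?_⟩
    rw [powMonoidHom_apply, h1, pow_one]
  · congr 1
    have hp : 1 < n i := by
      have := NeZero.ne (n i)
      omega
    obtain ⟨m, hm⟩ : ∃ m, n i = m + 1 := ⟨n i - 1, by omega⟩
    haveI : Fact (1 < n i) := ⟨hp⟩
    have hv : ∀ t, t < n i → (carry n i a).1 (gen n i, gen n i ^ t) = a ^ ((1 + t) / n i) := by
      intro t ht
      rw [carry_apply]
      simp only [Pi.pow_apply, gen, Pi.mulSingle_eq_same, toAdd_pow, toAdd_ofAdd, nsmul_eq_mul,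
        mul_one, ZMod.val_one, ZMod.val_natCast, Nat.mod_eq_of_lt ht]
    rw [nrm_apply, Finset.prod_congr rfl fun t ht => hv t (Finset.mem_range.mp ht)]
    rw [hm, Finset.prod_range_succ, Finset.prod_eq_one, one_mul, add_comm, Nat.div_self (by omega),
      pow_one]
    intro t ht
    rw [Finset.mem_range] at ht
    rw [Nat.div_eq_of_lt (by omega), pow_zero]

lemma nrm_bil [∀ i, NeZero (n i)] {i j : Fin k} (hij : i < j) (b : A) (hi hj) (l : Fin k) :
    nrm (n l) (gen n l) (bil n i j b hi hj) = 1 := by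
  rw [nrm_apply]
  refine Finset.prod_eq_one fun t _ => ?_
  rw [bil_apply]
  by_cases h : i = l
  · have h' : j ≠ l := by rintro rfl; exact hij.ne h
    simp only [Pi.pow_apply, gen_ne n h']
    simp
  · simp only [gen_ne n h]
    simp

lemma om_carry [∀ i, NeZero (n i)] (l i j : Fin k) (a : A) :
    om (carry n l a) (gen n j) (gen n i) = 1 := by
  rw [om_apply, carry_apply, carry_apply, mul_inv_eq_one]
  dsimp only
  rw [add_comm]

lemma om_bil_self [∀ i, NeZero (n i)] {i j : Fin k} (hij : i < j) (b : A) (hi hj) :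
    om (bil n i j b hi hj) (gen n j) (gen n i) = b := by
  rw [om_apply, bil_apply, bil_apply]
  simp only [gen_ne n hij.ne, gen_ne n hij.ne']
  simp only [gen, Pi.mulSingle_eq_same, toAdd_ofAdd, toAdd_one, ZMod.val_zero, zero_mul, pow_zero,
    inv_one, mul_one]
  by_cases h1 : n i = 1
  · rw [h1, pow_one] at hi
    rw [hi, one_pow]
  by_cases h2 : n j = 1
  · rw [h2, pow_one] at hj
    rw [hj, one_pow]
  have := NeZero.ne (n i)
  have := NeZero.ne (n j)
  haveI : Fact (1 < n i) := ⟨by omega⟩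
  haveI : Fact (1 < n j) := ⟨by omega⟩
  rw [ZMod.val_one, ZMod.val_one, mul_one, pow_one]

lemma om_bil_ne [∀ i, NeZero (n i)] {i j i' j' : Fin k} (hij : i < j) (hij' : i' < j')
    (hne : ¬ (i = i' ∧ j = j')) (b : A) (hi hj) :
    om (bil n i j b hi hj) (gen n j') (gen n i') = 1 := by
  have key : ∀ u v : Fin k, ¬ (i = u ∧ j = v) →
      (bil n i j b hi hj).1 (gen n u, gen n v) = 1 := by
    intro u v h
    rw [bil_apply]
    by_cases hu : i = u
    · have hv : j ≠ v := fun hv => h ⟨hu, hv⟩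
      simp only [gen_ne n hv]
      simp
    · simp only [gen_ne n hu]
      simp
  rw [om_apply, key _ _ hne, key, inv_one, mul_one]
  rintro ⟨rfl, rfl⟩
  exact absurd hij (not_lt.mpr hij'.le)

lemma Phi_surj [∀ i, NeZero (n i)] : Function.Surjective (Phi n A) := by
  rintro ⟨x, y⟩
  choose a ha using fun i => QuotientGroup.mk_surjective (x i)
  let D : {p : Fin k × Fin k // p.1 < p.2} → cocycles2 (∀ i, Multiplicative (ZMod (n i))) A :=
    fun p => bil n p.1.1 p.1.2 (y p).1 (y p).2.1 (y p).2.2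
  refine ⟨(∏ i, carry n i (a i)) * ∏ p, D p, ?_⟩
  refine Prod.ext (funext fun i => ?_) (funext fun q => ?_)
  · change (QuotientGroup.mk' (powMonoidHom (n i) : A →* A).range) (nrm (n i) (gen n i) _) = x i
    have hD : ∏ p, nrm (n i) (gen n i) (D p) = 1 :=
      Finset.prod_eq_one (fun p _ => nrm_bil n p.2 _ _ _ i)
    rw [map_mul (nrm (A := A) (n i) (gen n i)), map_prod (nrm (A := A) (n i) (gen n i)),
      map_prod (nrm (A := A) (n i) (gen n i)),
      hD, mul_one,
      Finset.prod_eq_single i (fun j _ hj => nrm_carry_ne n hj _) (by simp)]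
    exact (nrm_carry_self n i _).trans (ha i)
  · change pairHom n q.1.1 q.1.2 _ = y q
    rw [map_mul, map_prod, map_prod,
      Finset.prod_eq_one (fun l _ => Subtype.ext (om_carry n l _ _ _)), one_mul,
      Finset.prod_eq_single q]
    · exact Subtype.ext (om_bil_self n q.2 _ _ _)
    · intro p _ hp
      refine Subtype.ext (om_bil_ne n p.2 q.2 ?_ _ _ _)
      rintro ⟨h1, h2⟩
      exact hp (Subtype.ext (Prod.ext h1 h2))
    · simp

end prod
end H2aux

/-- for `G = G₁ × ⋯ × G_k` a finite abelian group with `Gᵢ` cyclic of order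
`nᵢ`, acting trivially on an abelian group `A`,
`H²(G, A) ≅ (⨁ᵢ A/nᵢA) ⊕ (⨁_{i<j} Ann_A(nᵢ) ∩ Ann_A(n_j))`.
Multiplicatively, `A/nA` is `A` modulo `n`-th powers and `Ann_A(n)` is the kernel of the
`n`-th power map. -/
theorem stmt1 (k : ℕ) (n : Fin k → ℕ) (hpos : ∀ i, 0 < n i) (A : Type*) [CommGroup A] :
    Nonempty (H2triv (∀ i, Multiplicative (ZMod (n i))) A ≃*
      ((∀ i, A ⧸ (powMonoidHom (n i) : A →* A).range) ×
        (∀ p : {p : Fin k × Fin k // p.1 < p.2},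
          ((powMonoidHom (n p.1.1) : A →* A).ker ⊓
            (powMonoidHom (n p.1.2) : A →* A).ker : Subgroup A)))) := by
  haveI : ∀ i, NeZero (n i) := fun i => ⟨(hpos i).ne'⟩
  exact ⟨(QuotientGroup.quotientMulEquivOfEq (H2aux.Phi_ker n).symm).trans
    (QuotientGroup.quotientKerEquivOfSurjective _ (H2aux.Phi_surj n))⟩
end

section
/- The number of graded-isomorphism classes of associative G-graded twisted R-algebras, for G = Z/n1 × ... × Z/nk with exactly s of the n_i even, equals 2^{s(s+1)/2}. -/
/-- Twisted multiplication on `G →₀ K` (the `K`-vector space with graded basis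
`w_g = single g 1`) determined by the structure constant `C`. -/
noncomputable def twistedMul {G K : Type*} [Group G] [Field K] (C : G → G → Kˣ)
    (f g : G →₀ K) : G →₀ K :=
  f.sum fun a ca => g.sum fun b cb => Finsupp.single (a * b) (ca * cb * (C a b : K))

/-- `φ` is a graded isomorphism between the `G`-graded twisted `K`-algebras with
structure constants `C1`, `C2`: a linear bijection that is multiplicative, unitarian
(the unit being `C(e,e)⁻¹ w_e`) and preserves each graded component. -/
def IsGradedIso {G K : Type*} [Group G] [Field K] (C1 C2 : G → G → Kˣ)
    (φ : (G →₀ K) ≃ₗ[K] (G →₀ K)) : Prop :=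
  (∀ f g : G →₀ K, φ (twistedMul C1 f g) = twistedMul C2 (φ f) (φ g)) ∧
  φ (Finsupp.single 1 (((C1 1 1)⁻¹ : Kˣ) : K)) =
    Finsupp.single 1 (((C2 1 1)⁻¹ : Kˣ) : K) ∧
  ∀ (g : G) (x : K), ∃ c : K, φ (Finsupp.single g x) = Finsupp.single g c

/-- `C` is a 2-cocycle, i.e. the twisted multiplication it defines is associative. -/
def IsCocycle {G A : Type*} [Group G] [CommGroup A] (C : G → G → A) : Prop :=
  ∀ a b c : G, C b c * C a (b * c) = C (a * b) c * C a b

namespace Stmt13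

/-- cohomologous -/
def Coh {G A : Type*} [Group G] [CommGroup A] (C1 C2 : G → G → A) : Prop :=
  ∃ u : G → A, ∀ a b, C1 a b * u (a * b) = u a * u b * C2 a b

theorem twistedMul_single {G K : Type*} [Group G] [Field K] (C : G → G → Kˣ) (a b : G) (x y : K) :
    twistedMul C (Finsupp.single a x) (Finsupp.single b y) =
      Finsupp.single (a * b) (x * y * (C a b : K)) := by
  unfold twistedMul
  rw [Finsupp.sum_single_index, Finsupp.sum_single_index]
  · simp
  · rw [Finsupp.sum_single_index] <;> simp

theorem coh_of_iso {G K : Type*} [Group G] [Field K] {C1 C2 : G → G → Kˣ}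
    {φ : (G →₀ K) ≃ₗ[K] (G →₀ K)} (h : IsGradedIso C1 C2 φ) : Coh C1 C2 := by
  obtain ⟨hm, -, hg⟩ := h
  choose c hc using fun g => hg g 1
  have hne : ∀ g, c g ≠ 0 := by
    intro g h0
    have h1 := hc g
    rw [h0, Finsupp.single_zero, LinearEquiv.map_eq_zero_iff] at h1
    simp at h1
  refine ⟨fun g => Units.mk0 (c g) (hne g), fun a b => ?_⟩
  have h1 := hm (Finsupp.single a 1) (Finsupp.single b 1)
  rw [twistedMul_single, hc, hc, twistedMul_single] at h1
  have h2 : (Finsupp.single (a * b) (1 * 1 * (C1 a b : K)) : G →₀ K)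
      = (C1 a b : K) • Finsupp.single (a * b) 1 := by simp
  rw [h2, map_smul, hc, Finsupp.smul_single] at h1
  have h3 := Finsupp.single_injective _ h1
  ext
  simpa using h3

theorem iso_of_coh {G K : Type*} [Group G] [Field K] {C1 C2 : G → G → Kˣ}
    (h : Coh C1 C2) : ∃ φ, IsGradedIso C1 C2 φ := by
  obtain ⟨u, hu⟩ := h
  let φ : (G →₀ K) ≃ₗ[K] (G →₀ K) :=
    LinearEquiv.ofLinearMap
      (Finsupp.lsum K fun g => (Finsupp.lsingle g).comp (LinearMap.lsmul K K (u g : K)))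
      (Finsupp.lsum K fun g => (Finsupp.lsingle g).comp (LinearMap.lsmul K K ((u g)⁻¹ : Kˣ)))
      (by ext g; simp) (by ext g; simp)
  have hφ : ∀ g x, φ (Finsupp.single g x) = Finsupp.single g ((u g : K) * x) := by
    intro g x
    simp [φ]
  refine ⟨φ, ?_, ?_, fun g x => ⟨_, hφ g x⟩⟩
  · intro f g
    have hadd1 : ∀ (C : G → G → Kˣ) (f f' g : G →₀ K),
        twistedMul C (f + f') g = twistedMul C f g + twistedMul C f' g := by
      intro C f f' g
      unfold twistedMul
      rw [Finsupp.sum_add_index']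
      · simp
      · intro a b c
        simp [add_mul, Finsupp.sum_add]
    have hadd2 : ∀ (C : G → G → Kˣ) (f g g' : G →₀ K),
        twistedMul C f (g + g') = twistedMul C f g + twistedMul C f g' := by
      intro C f g g'
      unfold twistedMul
      rw [← Finsupp.sum_add]
      congr 1
      ext1 a
      ext1 x
      rw [Finsupp.sum_add_index']
      · simp
      · intro a b c
        simp [add_mul, mul_add]
    induction f using Finsupp.induction_linear with
    | zero => simp [twistedMul]
    | add f f' h1 h2 => rw [hadd1, map_add, h1, h2, map_add, hadd1]
    | single a x =>
      induction g using Finsupp.induction_linear with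
      | zero => simp [twistedMul]
      | add g g' h1 h2 => rw [hadd2, map_add, h1, h2, map_add, hadd2]
      | single b y =>
        rw [twistedMul_single, hφ, hφ, hφ, twistedMul_single]
        congr 1
        have := congrArg (Units.val) (hu a b)
        push_cast at this
        linear_combination (x * y) * this
  · rw [hφ]
    congr 1
    have h1 := hu 1 1
    rw [mul_one] at h1
    have h2 : u 1 * (C1 1 1)⁻¹ = (C2 1 1)⁻¹ := by
      have : C1 1 1 = u 1 * C2 1 1 := by
        apply mul_right_cancel (b := u 1)
        rw [h1]
        exact mul_right_comm _ _ _
      rw [this, mul_inv, mul_inv_cancel_left]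
    rw [← h2]; simp

/-! ### Extensions -/

theorem cocycle_one_left {G A : Type*} [Group G] [CommGroup A] {C : G → G → A}
    (h : IsCocycle C) (b : G) : C 1 b = C 1 1 := by
  have := h 1 1 b
  simpa using this

/-- The abelian extension defined by a symmetric cocycle. -/
structure Ext {G A : Type*} [CommGroup G] [CommGroup A] (C : G → G → A)
    (h : IsCocycle C) (hs : ∀ a b, C a b = C b a) where
  /-- coefficient -/
  fst : A
  /-- group part -/
  snd : G

section
variable {G A : Type*} [CommGroup G] [CommGroup A] {C : G → G → A}
    {h : IsCocycle C} {hs : ∀ a b, C a b = C b a}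

instance : Mul (Ext C h hs) := ⟨fun p q => ⟨p.1 * q.1 * C p.2 q.2, p.2 * q.2⟩⟩
instance : One (Ext C h hs) := ⟨⟨(C 1 1)⁻¹, 1⟩⟩
instance : Inv (Ext C h hs) := ⟨fun p => ⟨p.1⁻¹ * (C 1 1)⁻¹ * (C p.2⁻¹ p.2)⁻¹, p.2⁻¹⟩⟩

theorem Ext.eq {p q : Ext C h hs} (h1 : p.1 = q.1) (h2 : p.2 = q.2) : p = q := by
  cases p; cases q; simp_all

theorem Ext.mul_fst (p q : Ext C h hs) : (p * q).1 = p.1 * q.1 * C p.2 q.2 := rfl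
theorem Ext.mul_snd (p q : Ext C h hs) : (p * q).2 = p.2 * q.2 := rfl
theorem Ext.one_fst : (1 : Ext C h hs).1 = (C 1 1)⁻¹ := rfl
theorem Ext.one_snd : (1 : Ext C h hs).2 = 1 := rfl
theorem Ext.inv_fst (p : Ext C h hs) : (p⁻¹).1 = p.1⁻¹ * (C 1 1)⁻¹ * (C p.2⁻¹ p.2)⁻¹ := rfl
theorem Ext.inv_snd (p : Ext C h hs) : (p⁻¹).2 = p.2⁻¹ := rfl

instance : Group (Ext C h hs) := Group.ofLeftAxioms
  (by
    intro p q r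
    apply Ext.eq
    · simp only [Ext.mul_fst, Ext.mul_snd]
      have := h p.2 q.2 r.2
      calc p.1 * q.1 * C p.2 q.2 * r.1 * C (p.2 * q.2) r.2
          = p.1 * q.1 * r.1 * (C (p.2 * q.2) r.2 * C p.2 q.2) := by
            simp only [mul_comm, mul_left_comm, mul_assoc]
        _ = _ := by
            rw [← this]
            simp only [mul_comm, mul_left_comm, mul_assoc]
    · simp only [Ext.mul_snd, mul_assoc])
  (by
    intro p
    apply Ext.eq
    · simp only [Ext.mul_fst, Ext.one_fst, Ext.one_snd]
      rw [cocycle_one_left h p.2, mul_right_comm]; simp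
    · simp [Ext.mul_snd, Ext.one_snd])
  (by
    intro p
    apply Ext.eq
    · simp only [Ext.mul_fst, Ext.one_fst, Ext.inv_fst, Ext.inv_snd]
      generalize C p.2⁻¹ p.2 = x
      generalize C 1 1 = y
      rw [mul_right_comm _ p.1, inv_mul_cancel_right, mul_right_comm]; simp
    · simp [Ext.mul_snd, Ext.one_snd, Ext.inv_snd])

instance : CommGroup (Ext C h hs) :=
  { (inferInstance : Group (Ext C h hs)) with
    mul_comm := by
      intro p q
      apply Ext.eq
      · simp only [Ext.mul_fst]
        rw [hs, mul_comm p.1]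
      · simp only [Ext.mul_snd, mul_comm] }

/-- projection -/
def Ext.proj : Ext C h hs →* G where
  toFun p := p.2
  map_one' := rfl
  map_mul' _ _ := rfl

theorem Ext.pow_eq (x : A) (e : G) (t : ℕ) :
    (⟨x, e⟩ : Ext C h hs) ^ t =
      ⟨x ^ t * (∏ j ∈ Finset.range t, C e (e ^ j)) * (C 1 1)⁻¹, e ^ t⟩ := by
  induction t with
  | zero => apply Ext.eq <;> simp [Ext.one_fst, Ext.one_snd]
  | succ t ih =>
    rw [pow_succ' (⟨x, e⟩ : Ext C h hs), ih]
    apply Ext.eq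
    · rw [Ext.mul_fst, Finset.prod_range_succ, pow_succ]
      simp only [mul_comm, mul_left_comm, mul_assoc]
    · exact (pow_succ' e t).symm

end

theorem aux1a {A : Type*} [AddCommGroup A] (z p q r s t : A) :
    q + (z + p - r) - t - (z + s - t) = (p - s) + (q - r) := by abel

theorem aux1 {A : Type*} [CommGroup A] (z p q r s t : A) :
    q * (z * p / r) / t / (z * s / t) = (p / s) * (q / r) :=
  aux1a (A := Additive A) z p q r s t

theorem aux2a {A : Type*} [AddCommGroup A] (x p q r s : A) :
    x + (p - q) + (s + q - r) = (x + s) + (p - r) := by abel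

theorem aux2 {A : Type*} [CommGroup A] (x p q r s : A) :
    x * (p / q) * (s * q / r) = (x * s) * (p / r) :=
  aux2a (A := Additive A) x p q r s

/-- commutator pairing is multiplicative -/
theorem comm_mul {G A : Type*} [CommGroup G] [CommGroup A] {C : G → G → A}
    (h : IsCocycle C) (a b x : G) :
    C (a * b) x / C x (a * b) = (C a x / C x a) * (C b x / C x b) := by
  have h1 := h a b x
  have h2 := h x a b
  have h3 := h a x b
  rw [mul_comm x a] at h2
  rw [mul_comm x b] at h3
  have e1 : C (a * b) x = C b x * C a (b * x) / C a b := by rw [h1]; simp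
  have e2 : C x (a * b) = C (a * x) b * C x a / C a b := by rw [← h2]; simp
  have e3 : C a (b * x) = C (a * x) b * C a x / C x b := by rw [← h3]; simp
  rw [e1, e2, e3]
  exact aux1 _ _ _ _ _ _

/-- commutator pairing as a bimultiplicative map -/
def commHom {G A : Type*} [CommGroup G] [CommGroup A] {C : G → G → A}
    (h : IsCocycle C) : G →* G →* A :=
  MonoidHom.mk' (fun a => MonoidHom.mk' (fun b => C a b / C b a) (by
    intro b c
    have := comm_mul h b c a
    rw [← inv_inj, inv_div, this, mul_inv, inv_div, inv_div])) (by
    intro a b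
    ext x
    exact comm_mul h a b x)

theorem exists_root (m : ℕ) (hm : 0 < m) (r : ℝˣ) (hr : Even m → 0 < (r : ℝ)) :
    ∃ x : ℝˣ, x ^ m = r := by
  suffices ∃ x : ℝ, x ^ m = r by
    obtain ⟨x, hx⟩ := this
    have hx0 : x ≠ 0 := by
      rintro rfl
      rw [zero_pow hm.ne'] at hx
      exact r.ne_zero hx.symm
    exact ⟨Units.mk0 x hx0, by ext; simpa using hx⟩
  by_cases h0 : 0 < (r : ℝ)
  · exact ⟨(r : ℝ) ^ ((m : ℝ)⁻¹), Real.rpow_inv_natCast_pow h0.le hm.ne'⟩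
  · have ho : Odd m := by
      rw [← Nat.not_even_iff_odd]; exact fun h => h0 (hr h)
    refine ⟨-((-(r : ℝ)) ^ ((m : ℝ)⁻¹)), ?_⟩
    rw [ho.neg_pow, Real.rpow_inv_natCast_pow (by linarith) hm.ne', neg_neg]

section main
variable {k : ℕ} (n : Fin k → ℕ)

/-- the group -/
abbrev Gp := ∀ i, Multiplicative (ZMod (n i))

/-- generators -/
def gen (i : Fin k) : Gp n := Pi.mulSingle i (Multiplicative.ofAdd 1)

theorem gen_pow (i : Fin k) (t : ℕ) :
    gen n i ^ t = Pi.mulSingle i (Multiplicative.ofAdd (t : ZMod (n i))) := by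
  rw [gen, ← Pi.mulSingle_pow, ← ofAdd_nsmul]; simp

theorem gen_pow_self (i : Fin k) : gen n i ^ n i = 1 := by
  rw [gen_pow]; simp

theorem hom_zmod_ext {m : ℕ} {H : Type*} [Monoid H] {f g : Multiplicative (ZMod m) →* H}
    (h : f (Multiplicative.ofAdd 1) = g (Multiplicative.ofAdd 1)) (hm : 0 < m) : f = g := by
  have : NeZero m := ⟨hm.ne'⟩
  apply MonoidHom.ext
  intro x
  have : x = (Multiplicative.ofAdd (1 : ZMod m)) ^ (ZMod.val (Multiplicative.toAdd x : ZMod m)) := by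
    rw [← ofAdd_nsmul]; simp
  rw [this, map_pow, map_pow, h]

theorem hom_ext {H : Type*} [CommMonoid H] (hpos : ∀ i, 0 < n i) {f g : Gp n →* H}
    (h : ∀ i, f (gen n i) = g (gen n i)) : f = g := by
  apply MonoidHom.pi_ext
  intro i x
  have : f.comp (MonoidHom.mulSingle _ i) = g.comp (MonoidHom.mulSingle _ i) :=
    hom_zmod_ext (h i) (hpos i)
  exact DFunLike.congr_fun this x

theorem exists_hom {H : Type*} [CommGroup H] (w : Fin k → H) (hw : ∀ i, w i ^ n i = 1) :
    ∃ f : Gp n →* H, ∀ i, f (gen n i) = w i := by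
  have : ∀ i, ∃ f : Multiplicative (ZMod (n i)) →* H, f (Multiplicative.ofAdd 1) = w i := by
    intro i
    let f0 : ZMod (n i) →+ Additive H := ZMod.lift (n i)
      ⟨zmultiplesHom (Additive H) (Additive.ofMul (w i)), by
        simp [← ofMul_pow, hw i]⟩
    refine ⟨AddMonoidHom.toMultiplicativeLeft f0, ?_⟩
    have : f0 ((1 : ℤ) : ZMod (n i)) = Additive.ofMul (w i) := by
      simp only [f0, ZMod.lift_coe]; simp
    rw [Int.cast_one] at this
    exact congrArg Additive.toMul this
  choose f hf using this
  refine ⟨∏ i, (f i).comp (Pi.evalMonoidHom _ i), fun i => ?_⟩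
  rw [MonoidHom.finsetProd_apply, Finset.prod_eq_single i]
  · simp [gen, hf]
  · intro j _ hj
    simp [gen, Pi.mulSingle_eq_of_ne hj]
  · simp

/-- A cocycle with trivial invariants is a coboundary. -/
theorem trivial_of_inv (hpos : ∀ i, 0 < n i) (C : Gp n → Gp n → ℝˣ) (h : IsCocycle C)
    (h1 : ∀ i, Even (n i) → 0 < ((∏ t ∈ Finset.range (n i), C (gen n i) (gen n i ^ t) : ℝˣ) : ℝ))
    (h2 : ∀ i j, i < j → Even (n i) → Even (n j) →
      0 < ((C (gen n i) (gen n j) / C (gen n j) (gen n i) : ℝˣ) : ℝ)) :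
    ∃ x : Gp n → ℝˣ, ∀ a b, C a b * (x a * x b) = x (a * b) := by
  have hc : ∀ i j, i < j → commHom h (gen n i) (gen n j) = 1 := by
    intro i j hij
    set c := commHom h (gen n i) (gen n j) with hcdef
    have p1 : c ^ n i = 1 := by
      have : commHom h (gen n i ^ n i) (gen n j) = 1 := by rw [gen_pow_self]; simp
      rw [← this, map_pow]; rfl
    have p2 : c ^ n j = 1 := by
      have : commHom h (gen n i) (gen n j ^ n j) = 1 := by rw [gen_pow_self]; simp
      rw [← this, map_pow]
    have q1 : (c : ℝ) ^ n i = 1 := by rw [← Units.val_pow_eq_pow_val, p1, Units.val_one]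
    have q2 : (c : ℝ) ^ n j = 1 := by rw [← Units.val_pow_eq_pow_val, p2, Units.val_one]
    have hc0 : 0 < (c : ℝ) := by
      by_cases e1 : Even (n i)
      · by_cases e2 : Even (n j)
        · exact h2 i j hij e1 e2
        · exact (Nat.not_even_iff_odd.1 e2).pow_pos_iff.1 (by rw [q2]; exact one_pos)
      · exact (Nat.not_even_iff_odd.1 e1).pow_pos_iff.1 (by rw [q1]; exact one_pos)
    ext
    exact (pow_eq_one_iff_of_nonneg hc0.le (hpos i).ne').1 q1
  have hanti : ∀ a b, commHom h a b = (commHom h b a)⁻¹ := by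
    intro a b
    exact (inv_div _ _).symm
  have hc' : ∀ i j, commHom h (gen n i) (gen n j) = 1 := by
    intro i j
    rcases lt_trichotomy i j with hij | hij | hij
    · exact hc i j hij
    · subst hij
      exact div_self' _
    · rw [hanti, hc j i hij, inv_one]
  have hz : commHom h = 1 := by
    apply hom_ext n hpos
    intro i
    apply hom_ext n hpos
    intro j
    exact hc' i j
  have hs : ∀ a b, C a b = C b a := by
    intro a b
    have : commHom h a b = 1 := by rw [hz]; rfl
    exact div_eq_one.1 this
  have hw : ∀ i, ∃ w : Ext C h hs, w ^ n i = 1 ∧ w.2 = gen n i := by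
    intro i
    obtain ⟨x, hx⟩ := exists_root (n i) (hpos i)
      (∏ t ∈ Finset.range (n i), C (gen n i) (gen n i ^ t))⁻¹ (by
        intro he
        rw [Units.val_inv_eq_inv_val]
        exact inv_pos.2 (h1 i he))
    refine ⟨⟨x, gen n i⟩, ?_, rfl⟩
    rw [Ext.pow_eq, hx, gen_pow_self, inv_mul_cancel, one_mul]
    rfl
  choose w hw1 hw2 using hw
  obtain ⟨f, hf⟩ := exists_hom n w hw1
  have hp : Ext.proj.comp f = MonoidHom.id (Gp n) := by
    apply hom_ext n hpos
    intro i
    show (f (gen n i)).2 = gen n i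
    rw [hf, hw2]
  have hp' : ∀ g, (f g).2 = g := fun g => DFunLike.congr_fun hp g
  refine ⟨fun g => (f g).1, fun a b => ?_⟩
  show _ = (f (a * b)).1
  rw [map_mul, Ext.mul_fst, hp', hp', mul_comm]

/-- index set of invariants -/
abbrev Ev := {i : Fin k // Even (n i)}

/-- index set of invariants -/
abbrev Tt := {p : Ev n × Ev n // p.1 ≤ p.2}

/-- the invariant as multiplicative map -/
def K (p : Tt n) : (Gp n → Gp n → ℝˣ) →* ℝˣ where
  toFun C := if p.1.1 = p.1.2 then ∏ t ∈ Finset.range (n p.1.1), C (gen n p.1.1) (gen n p.1.1 ^ t)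
    else C (gen n p.1.1) (gen n p.1.2) / C (gen n p.1.2) (gen n p.1.1)
  map_one' := by split_ifs <;> simp
  map_mul' C D := by
    split_ifs
    · simp [Finset.prod_mul_distrib]
    · simp [mul_div_mul_comm]

theorem K_pos_of_coh (p : Tt n) (u : Gp n → ℝˣ) :
    0 < (K n p (fun a b => u a * u b / u (a * b)) : ℝ) := by
  show 0 < ((if p.1.1 = p.1.2 then _ else _ : ℝˣ) : ℝ)
  split_ifs with hp
  · set e := gen n p.1.1 with he
    have key : ∀ t, ∏ j ∈ Finset.range t, (u e * u (e ^ j) / u (e * e ^ j)) =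
        u e ^ t * (u 1 / u (e ^ t)) := by
      intro t
      induction t with
      | zero => simp
      | succ t ih =>
        rw [Finset.prod_range_succ, ih, pow_succ' e t, pow_succ]
        exact aux2 _ _ _ _ _
    rw [key, he, gen_pow_self, div_self', mul_one, Units.val_pow_eq_pow_val]
    exact p.1.1.2.pow_pos (Units.ne_zero _)
  · beta_reduce
    rw [mul_comm (gen n p.1.2) (gen n p.1.1), mul_comm (u (gen n p.1.2)), div_self']
    simp

theorem coh_iff (hpos : ∀ i, 0 < n i) (C1 C2 : Gp n → Gp n → ℝˣ) (h1 : IsCocycle C1)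
    (h2 : IsCocycle C2) :
    Coh C1 C2 ↔ ∀ p, (0 < (K n p C1 : ℝ) ↔ 0 < (K n p C2 : ℝ)) := by
  constructor
  · rintro ⟨u, hu⟩ p
    have : C1 = (fun a b => u a * u b / u (a * b)) * C2 := by
      ext1 a; ext1 b
      show _ = _ / _ * C2 a b
      rw [div_mul_eq_mul_div, ← hu, mul_div_cancel_right]
    rw [this, map_mul, Units.val_mul]
    exact mul_pos_iff_of_pos_left (K_pos_of_coh n p u)
  · intro h
    have hcd : IsCocycle (C1 / C2) := by
      intro a b c
      simp only [Pi.div_apply]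
      rw [div_mul_div_comm, div_mul_div_comm, h1, h2]
    have hK : ∀ p, 0 < (K n p (C1 / C2) : ℝ) := by
      intro p
      rw [map_div, Units.val_div_eq_div_val]
      by_cases h0 : 0 < (K n p C1 : ℝ)
      · exact div_pos h0 ((h p).1 h0)
      · have h3 : ¬ 0 < (K n p C2 : ℝ) := fun h' => h0 ((h p).2 h')
        have e1 := (K n p C1).ne_zero
        have e2 := (K n p C2).ne_zero
        exact div_pos_of_neg_of_neg (lt_of_le_of_ne (not_lt.1 h0) e1)
          (lt_of_le_of_ne (not_lt.1 h3) e2)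
    obtain ⟨x, hx⟩ := trivial_of_inv n hpos (C1 / C2) hcd
      (by
        intro i he
        have := hK ⟨(⟨i, he⟩, ⟨i, he⟩), le_rfl⟩
        change 0 < ((if _ then _ else _ : ℝˣ) : ℝ) at this
        rw [if_pos rfl] at this
        exact this)
      (by
        intro i j hij hi hj
        have := hK ⟨(⟨i, hi⟩, ⟨j, hj⟩), hij.le⟩
        change 0 < ((if _ then _ else _ : ℝˣ) : ℝ) at this
        rw [if_neg (by intro h; exact hij.ne (congrArg Subtype.val h))] at this
        exact this)
    refine ⟨fun g => (x g)⁻¹, fun a b => ?_⟩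
    have := hx a b
    beta_reduce
    rw [← this]
    show C1 a b * (C1 a b / C2 a b * _)⁻¹ = _
    rw [mul_inv, inv_div, mul_inv, ← mul_assoc, mul_div_cancel, mul_comm]

/-- exponent cast -/
def vl (i : Fin k) (a : Gp n) : ℕ := (Multiplicative.toAdd (a i)).val

/-- basic cocycles -/
def basic (p : Tt n) : Gp n → Gp n → ℝˣ := fun a b =>
  if p.1.1 = p.1.2 then (-1) ^ ((vl n p.1.1 a + vl n p.1.1 b) / n p.1.1)
  else (-1) ^ (vl n p.1.1 a * vl n p.1.2 b)

theorem vl_mul (hpos : ∀ i, 0 < n i) (i : Fin k) (a b : Gp n) :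
    vl n i (a * b) = (vl n i a + vl n i b) % n i := by
  have : NeZero (n i) := ⟨(hpos i).ne'⟩
  exact ZMod.val_add _ _

theorem vl_gen_pow (i j : Fin k) (t : ℕ) :
    vl n j (gen n i ^ t) = if i = j then t % n j else 0 := by
  rw [gen_pow, vl]
  split_ifs with h
  · subst h
    simp [ZMod.val_natCast]
  · rw [Pi.mulSingle_eq_of_ne (Ne.symm h)]; simp

theorem vl_gen (i j : Fin k) :
    vl n j (gen n i) = if i = j then 1 % n j else 0 := by
  simpa using vl_gen_pow n i j 1

theorem neg_one_pow_mod_mul {m : ℕ} (hm : Even m) (x y : ℕ) :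
    (-1 : ℝˣ) ^ (x % m * y) = (-1) ^ (x * y) := by
  rw [pow_mul, pow_mul]
  congr 1
  conv_rhs => rw [← Nat.mod_add_div x m, pow_add, pow_mul, hm.neg_one_pow, one_pow, mul_one]

theorem basic_cocycle (hpos : ∀ i, 0 < n i) (p : Tt n) : IsCocycle (basic n p) := by
  intro a b c
  unfold basic
  split_ifs with h
  · rw [← pow_add, ← pow_add]
    congr 1
    rw [vl_mul n hpos, vl_mul n hpos]
    have hm := hpos p.1.1
    generalize vl n p.1.1 a = x
    generalize vl n p.1.1 b = y
    generalize vl n p.1.1 c = z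
    generalize n p.1.1 = m at hm
    have e1 := Nat.add_mul_div_left (x + (y + z) % m) ((y + z) / m) hm
    have e2 := Nat.add_mul_div_left ((x + y) % m + z) ((x + y) / m) hm
    have f1 := Nat.mod_add_div (y + z) m
    have f2 := Nat.mod_add_div (x + y) m
    have g : x + (y + z) % m + m * ((y + z) / m) = (x + y) % m + z + m * ((x + y) / m) := by
      omega
    rw [g, e2] at e1
    omega
  · rw [vl_mul n hpos, vl_mul n hpos, neg_one_pow_mod_mul p.1.1.2,
      mul_comm (vl n p.1.1 a) (_ % _), neg_one_pow_mod_mul p.1.2.2, ← pow_add, ← pow_add]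
    congr 1
    ring

theorem K_basic (hpos : ∀ i, 0 < n i) (q p : Tt n) :
    K n q (basic n p) = if p = q then -1 else 1 := by
  obtain ⟨⟨⟨i, hi⟩, ⟨l, hl⟩⟩, hil⟩ := q
  obtain ⟨⟨⟨j, hj⟩, ⟨m, hm⟩⟩, hjm⟩ := p
  change i ≤ l at hil
  change j ≤ m at hjm
  have two : ∀ i, Even (n i) → 1 % n i = 1 := by
    intro i hi
    have := hpos i
    obtain ⟨r, hr⟩ := hi
    exact Nat.mod_eq_of_lt (by omega)
  show (if _ then _ else _ : ℝˣ) = _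
  simp only [Subtype.mk.injEq, Prod.mk.injEq, basic]
  by_cases h1 : i = l
  · subst h1
    rw [if_pos rfl]
    by_cases h2 : j = m
    · subst h2
      simp only [if_true, and_self, vl_gen, vl_gen_pow]
      by_cases h3 : i = j
      · subst h3
        simp only [if_true]
        rw [two i hi]
        obtain ⟨r, hr⟩ : ∃ r, n i = r + 1 := ⟨n i - 1, by have := hpos i; omega⟩
        rw [hr, Finset.prod_range_succ, Finset.prod_eq_one]
        · rw [Nat.mod_eq_of_lt (by omega), add_comm 1 r, Nat.div_self (by omega)]; simp
        · intro t ht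
          rw [Finset.mem_range] at ht
          rw [Nat.mod_eq_of_lt (by omega), Nat.div_eq_of_lt (by omega)]; simp
      · simp [h3, Ne.symm h3]
    · simp only [vl_gen, vl_gen_pow, if_neg h2]
      rw [if_neg (c := j = i ∧ m = i) (by rintro ⟨rfl, rfl⟩; exact h2 rfl)]
      apply Finset.prod_eq_one
      intro t _
      by_cases h3 : i = j
      · rw [if_neg (c := i = m) (by rintro rfl; exact h2 h3.symm)]; simp
      · rw [if_neg h3]; simp
  · rw [if_neg h1]
    by_cases h2 : j = m
    · subst h2
      rw [if_neg (c := j = i ∧ j = l) (by rintro ⟨rfl, rfl⟩; exact h1 rfl), if_pos rfl, if_pos rfl,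
        add_comm, div_self']
    · simp only [vl_gen, if_neg h2]
      have hlt : j < m := lt_of_le_of_ne hjm h2
      have hlt' : i < l := lt_of_le_of_ne hil h1
      have hz : (if l = j then 1 % n j else 0) * (if i = m then 1 % n m else 0) = 0 := by
        by_cases h3 : l = j
        · rw [if_neg (c := i = m) (by rintro rfl; subst h3; exact lt_asymm hlt hlt')]; simp
        · rw [if_neg h3]; simp
      rw [hz, two j hj, two m hm]
      by_cases h3 : i = j
      · by_cases h4 : l = m
        · simp [h3, h4]
        · simp [h3, h4, Ne.symm h4]
      · simp [h3, Ne.symm h3]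

theorem exists_cocycle (hpos : ∀ i, 0 < n i) (f : Tt n → Prop) :
    ∃ C : Gp n → Gp n → ℝˣ, IsCocycle C ∧ ∀ p, (0 < (K n p C : ℝ) ↔ f p) := by
  classical
  refine ⟨∏ p, if f p then 1 else basic n p, ?_, ?_⟩
  · intro a b c
    simp only [Finset.prod_apply]
    rw [← Finset.prod_mul_distrib, ← Finset.prod_mul_distrib]
    apply Finset.prod_congr rfl
    intro p _
    split_ifs
    · simp
    · exact basic_cocycle n hpos p a b c
  · intro q
    rw [map_prod, Finset.prod_eq_single q]
    · split_ifs with h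
      · simp [h]
      · rw [K_basic n hpos, if_pos rfl]
        simp [h]
    · intro p _ hp
      split_ifs
      · simp
      · rw [K_basic n hpos, if_neg hp]
    · simp

theorem card_Tt : Fintype.card (Tt n) =
    (Finset.univ.filter fun i => Even (n i)).card *
      ((Finset.univ.filter fun i => Even (n i)).card + 1) / 2 := by
  rw [← Fintype.card_congr (Sym2.sortEquiv (α := Ev n)), Sym2.card, Fintype.card_subtype,
    Nat.choose_two_right, Nat.add_sub_cancel, mul_comm]

end main

end Stmt13

/-- the number of graded-isomorphism classes of associative
`G`-graded twisted ℝ-algebras, for `G = ℤ/n₁ × ⋯ × ℤ/n_k` with exactly `s` of the `nᵢ`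
even, equals `2^{s(s+1)/2}`. -/
theorem stmt13 (k : ℕ) (n : Fin k → ℕ) (hpos : ∀ i, 0 < n i) (s : ℕ)
    (hs : (Finset.univ.filter fun i => Even (n i)).card = s) :
    Nat.card (Quot fun C1 C2 :
        {C : (∀ i, Multiplicative (ZMod (n i))) → (∀ i, Multiplicative (ZMod (n i))) → ℝˣ //
          IsCocycle C} =>
        ∃ φ, IsGradedIso C1.1 C2.1 φ) = 2 ^ (s * (s + 1) / 2) := by
  classical
  subst hs
  rw [← Stmt13.card_Tt]
  have hinv : ∀ C1 C2 : {C : (∀ i, Multiplicative (ZMod (n i))) →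
      (∀ i, Multiplicative (ZMod (n i))) → ℝˣ // IsCocycle C},
      (∃ φ, IsGradedIso C1.1 C2.1 φ) ↔
        (fun p => 0 < (Stmt13.K n p C1.1 : ℝ)) = (fun p => 0 < (Stmt13.K n p C2.1 : ℝ)) := by
    intro C1 C2
    rw [funext_iff]
    simp only [eq_iff_iff]
    rw [← Stmt13.coh_iff n hpos C1.1 C2.1 C1.2 C2.2]
    exact ⟨fun ⟨φ, h⟩ => Stmt13.coh_of_iso h, Stmt13.iso_of_coh⟩
  have hb : Function.Bijective (Quot.lift (r := fun C1 C2 : {C : (∀ i, Multiplicative (ZMod (n i))) →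
      (∀ i, Multiplicative (ZMod (n i))) → ℝˣ // IsCocycle C} => ∃ φ, IsGradedIso C1.1 C2.1 φ)
      (fun C => (fun p => 0 < (Stmt13.K n p C.1 : ℝ) : Stmt13.Tt n → Prop))
      (fun C1 C2 h => (hinv C1 C2).1 h)) := by
    constructor
    · rintro ⟨C1⟩ ⟨C2⟩ h
      exact Quot.sound ((hinv C1 C2).2 h)
    · intro f
      obtain ⟨C, hC, hf⟩ := Stmt13.exists_cocycle n hpos f
      exact ⟨Quot.mk _ ⟨C, hC⟩, funext fun p => propext (hf p)⟩
  rw [Nat.card_eq_of_bijective _ hb]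
  simp [Nat.card_eq_fintype_card]
end
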